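/- Let G be a countably infinite subgroup of 𝕋. Then there exist an arithmetic sequence (a_n) and an arithmetic-type sequence (e_n) associated with (a_n) such that G = t_{(e_n)}(𝕋) if and only if G is torsion (every element of G has finite order). -/

import Mathlib

open Filter Topology

noncomputable section

/-- The circle group `𝕋 = ℝ/ℤ`. -/
abbrev Circle1 : Type := AddCircle (1 : ℝ)

/-- An arithmetic sequence `(a_n)_{n ≥ 1}`, with the convention `a 0 = 1`:
a strictly increasing sequence of positive integers with `1 < a 1` and `a n ∣ a (n+1)`. -/
def IsArithSeq (a : ℕ → ℕ) : Prop :=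
  a 0 = 1 ∧ StrictMono a ∧ ∀ n, a n ∣ a (n + 1)

/-- The ratio sequence: `q n = a n / a (n-1)` (so `q 1 = a 1`). -/
def ratioSeq (a : ℕ → ℕ) (n : ℕ) : ℕ := a n / a (n - 1)

/-- The subgroup of `𝕋` characterized by a sequence of integers `(u n)`. -/
def charSub (u : ℕ → ℕ) : Set Circle1 :=
  {x : Circle1 | Tendsto (fun n => (u n) • x) atTop (nhds 0)}

/-- The set `{r·a_{k-1} : k ≥ 1, 1 ≤ r ≤ q_k - 1}` whose increasing enumeration is `(d_n)`. -/
def DSet (a : ℕ → ℕ) : Set ℕ :=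
  {m | ∃ k, 1 ≤ k ∧ ∃ r, 1 ≤ r ∧ r ≤ ratioSeq a k - 1 ∧ m = r * a (k - 1)}

/-- `(d_n)` is the strictly increasing enumeration of `DSet a`. -/
def IsDSeq (a d : ℕ → ℕ) : Prop := StrictMono d ∧ Set.range d = DSet a

/-- An arithmetic-type sequence associated with the arithmetic sequence `(a_n)`:
a strictly increasing sequence of positive integers whose set of values contains all the
values `a k` (for `k ≥ 1`) and is contained in `DSet a`. -/
def IsArithTypeSeq (a e : ℕ → ℕ) : Prop :=
  StrictMono e ∧ (∀ k, 1 ≤ k → a k ∈ Set.range e) ∧ Set.range e ⊆ DSet a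

/-- `(c_n)_{n ≥ 1}` is the canonical representation of `x ∈ 𝕋` w.r.t. the arithmetic
sequence `(a_n)`: `0 ≤ c n ≤ q n - 1` for all `n ≥ 1`, `c n < q n - 1` infinitely often,
and `x = Σ_{n ≥ 1} c n / a n` in `𝕋`. -/
def IsCanonicalRep (a c : ℕ → ℕ) (x : Circle1) : Prop :=
  (∀ n, 1 ≤ n → c n ≤ ratioSeq a n - 1) ∧
  {n | 1 ≤ n ∧ c n < ratioSeq a n - 1}.Infinite ∧
  x = ((∑' n : ℕ, (c (n + 1) : ℝ) / (a (n + 1) : ℝ) : ℝ) : Circle1)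

/-- The support of a digit sequence: `supp(x) = {n ≥ 1 : c n ≠ 0}`. -/
def suppOf (c : ℕ → ℕ) : Set ℕ := {n | 1 ≤ n ∧ c n ≠ 0}

namespace IsArithSeq

variable {a : ℕ → ℕ}

theorem pos (ha : IsArithSeq a) (n : ℕ) : 0 < a n := by
  have h := ha.2.1.monotone (Nat.zero_le n)
  rw [ha.1] at h
  exact h

theorem succ_eq (ha : IsArithSeq a) (k : ℕ) : a (k + 1) = ratioSeq a (k + 1) * a k := by
  simp only [ratioSeq, Nat.add_sub_cancel]
  exact (Nat.div_mul_cancel (ha.2.2 k)).symm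

theorem two_le_ratioSeq (ha : IsArithSeq a) (k : ℕ) : 2 ≤ ratioSeq a (k + 1) := by
  have h1 := ha.2.1 (Nat.lt_succ_self k)
  rw [Nat.succ_eq_add_one, ha.succ_eq k] at h1
  by_contra! h
  have h2 := ha.pos k
  have : ratioSeq a (k + 1) * a k ≤ 1 * a k := Nat.mul_le_mul_right _ (by omega)
  omega

theorem two_pow_mul_le (ha : IsArithSeq a) (k j : ℕ) : 2 ^ j * a k ≤ a (k + j) := by
  induction j with
  | zero => simp
  | succ j ih =>
    rw [← add_assoc, ha.succ_eq (k + j), pow_succ]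
    calc 2 ^ j * 2 * a k = 2 * (2 ^ j * a k) := by ring
      _ ≤ _ := Nat.mul_le_mul (ha.two_le_ratioSeq _) ih

theorem dvd_of_le (ha : IsArithSeq a) {m n : ℕ} (h : m ≤ n) : a m ∣ a n := by
  induction n, h using Nat.le_induction with
  | base => exact dvd_rfl
  | succ n _ ih => exact ih.trans (ha.2.2 n)

theorem mem_DSet_iff (ha : IsArithSeq a) {m : ℕ} :
    m ∈ DSet a ↔ ∃ k r, 1 ≤ r ∧ r < ratioSeq a (k + 1) ∧ m = r * a k := by
  constructor
  · rintro ⟨k, hk, r, hr, hr', rfl⟩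
    obtain ⟨k, rfl⟩ := Nat.exists_eq_add_of_le' hk
    have := ha.two_le_ratioSeq k
    exact ⟨k, r, hr, by omega, rfl⟩
  · rintro ⟨k, r, hr, hr', rfl⟩
    exact ⟨k + 1, by omega, r, hr, by omega, rfl⟩

theorem mem_DSet (ha : IsArithSeq a) (k : ℕ) : a k ∈ DSet a :=
  ha.mem_DSet_iff.2 ⟨k, 1, le_rfl, ha.two_le_ratioSeq k, (one_mul _).symm⟩

theorem ratio_cast (ha : IsArithSeq a) (k : ℕ) :
    (a (k + 1) : ℝ) = ratioSeq a (k + 1) * a k := by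
  exact_mod_cast ha.succ_eq k

/-- An element `r * a k` of `DSet a` with `a K ≤ r * a k` has index `k ≥ K`. -/
theorem le_index (ha : IsArithSeq a) {K k r : ℕ} (hr : r < ratioSeq a (k + 1))
    (h : a K ≤ r * a k) : K ≤ k := by
  have h1 : r * a k < a (k + 1) := by
    rw [ha.succ_eq k]
    exact Nat.mul_lt_mul_of_pos_right hr (ha.pos k)
  exact Nat.lt_succ_iff.1 (ha.2.1.lt_iff_lt.1 (h.trans_lt h1))

end IsArithSeq

/-- A nonnegative bounded sequence that eventually at least doubles vanishes. -/
theorem eq_zero_of_doubling {v : ℕ → ℝ} {K : ℕ} {C : ℝ} (h0 : 0 ≤ v K)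
    (hC : ∀ k, v k ≤ C) (h : ∀ k, K ≤ k → 2 * v k ≤ v (k + 1)) : v K = 0 := by
  have key : ∀ j, 2 ^ j * v K ≤ v (K + j) := by
    intro j
    induction j with
    | zero => simp
    | succ j ih =>
      have := h (K + j) (by omega)
      rw [pow_succ, ← add_assoc]
      linarith
  by_contra hne
  have hpos : 0 < v K := lt_of_le_of_ne h0 (Ne.symm hne)
  obtain ⟨j, hj⟩ := pow_unbounded_of_one_lt (C / v K) (one_lt_two)
  rw [div_lt_iff₀ hpos] at hj
  linarith [key j, hC (K + j)]

theorem Circle1.norm_coe_le_abs (t : ℝ) : ‖(t : Circle1)‖ ≤ |t| := by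
  rw [UnitAddCircle.norm_eq]
  simpa using round_le t 0

theorem Circle1.norm_coe_eq_abs {t : ℝ} (h : |t| ≤ 1 / 2) : ‖(t : Circle1)‖ = |t| :=
  (AddCircle.norm_coe_eq_abs_iff (1 : ℝ) one_ne_zero).2 (by simpa using h)

theorem Circle1.norm_le_half (x : Circle1) : ‖x‖ ≤ 1 / 2 := by
  simpa using AddCircle.norm_le_half_period (1 : ℝ) (x := x) one_ne_zero

theorem Circle1.coe_intCast (m : ℤ) : ((m : ℝ) : Circle1) = 0 :=
  (AddCircle.coe_eq_zero_iff (1 : ℝ)).2 ⟨m, by simp⟩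

/-- Every point of the circle has a real representative of the same absolute value. -/
theorem Circle1.exists_rep (x : Circle1) : ∃ t : ℝ, (t : Circle1) = x ∧ |t| = ‖x‖ := by
  obtain ⟨z, rfl⟩ := QuotientAddGroup.mk_surjective x
  refine ⟨z - round z, ?_, (UnitAddCircle.norm_eq).symm⟩
  rw [AddCircle.coe_sub, Circle1.coe_intCast, sub_zero]

theorem Circle1.norm_nsmul_eq {x : Circle1} {q : ℕ} (hq : 1 < q)
    (h : ∀ r, 1 ≤ r → r < q → ‖r • x‖ ≤ 1 / 8) : ‖q • x‖ = q * ‖x‖ := by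
  obtain ⟨t, rfl, ht⟩ := Circle1.exists_rep x
  have h1 : |t| ≤ 1 / 8 := by
    rw [ht]
    simpa using h 1 le_rfl (by omega)
  have key : ∀ r : ℕ, 1 ≤ r → r ≤ q → |(r : ℝ) * t| ≤ 1 / 4 ∧
      ‖r • (t : Circle1)‖ = |(r : ℝ) * t| := by
    intro r hr
    induction r, hr using Nat.le_induction with
    | base => intro _; simpa [ht.symm] using h1.trans (by norm_num)
    | succ r hr ih =>
      intro hrq
      obtain ⟨-, h3⟩ := ih (by omega)
      have h4 := h r hr (by omega)
      rw [h3] at h4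
      have h5 : |((r + 1 : ℕ) : ℝ) * t| ≤ 1 / 4 := by
        push_cast
        rw [add_mul, one_mul]
        exact (abs_add_le _ _).trans (by linarith)
      refine ⟨h5, ?_⟩
      rw [← AddCircle.coe_nsmul, nsmul_eq_mul]
      exact Circle1.norm_coe_eq_abs (by linarith)
  rw [(key q (by omega) le_rfl).2, abs_mul, ht, Nat.abs_cast]

/-- `a k` times the tail from index `k` on of the series `∑ f n / a n`. -/
def tailSum (a : ℕ → ℕ) (f : ℕ → ℝ) (k : ℕ) : ℝ :=
  ∑' j, f (k + j) * ((a k : ℝ) / a (k + j))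

section tailSum

variable {a : ℕ → ℕ} {f : ℕ → ℝ}

theorem norm_tailSum_term_le (ha : IsArithSeq a) {M : ℝ} {k : ℕ}
    (hf : ∀ n, k ≤ n → |f n| ≤ M) (j : ℕ) :
    ‖f (k + j) * ((a k : ℝ) / a (k + j))‖ ≤ M * (1 / 2) ^ j := by
  have hM : 0 ≤ M := (abs_nonneg _).trans (hf k le_rfl)
  have hp : (0 : ℝ) < a (k + j) := by exact_mod_cast ha.pos _
  have h1 : (a k : ℝ) / a (k + j) ≤ (1 / 2) ^ j := by
    rw [div_le_iff₀ hp, one_div, inv_pow, ← div_eq_inv_mul, le_div_iff₀ (by positivity), mul_comm]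
    exact_mod_cast ha.two_pow_mul_le k j
  rw [norm_mul, Real.norm_eq_abs, Real.norm_of_nonneg (by positivity)]
  exact mul_le_mul (hf _ (by omega)) h1 (by positivity) hM

theorem abs_tailSum_le (ha : IsArithSeq a) {M : ℝ} {k : ℕ} (hf : ∀ n, k ≤ n → |f n| ≤ M) :
    |tailSum a f k| ≤ 2 * M := by
  rw [mul_comm]
  exact tsum_of_norm_bounded (hasSum_geometric_two.mul_left M) (norm_tailSum_term_le ha hf)

theorem tailSum_eq (ha : IsArithSeq a) {M : ℝ} (hf : ∀ n, |f n| ≤ M) (k : ℕ) :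
    ratioSeq a (k + 1) * tailSum a f k =
      ratioSeq a (k + 1) * f k + tailSum a f (k + 1) := by
  have hs : Summable fun j => f (k + j) * ((a k : ℝ) / a (k + j)) :=
    Summable.of_norm_bounded (hasSum_geometric_two.mul_left M).summable
      (norm_tailSum_term_le ha fun n _ => hf n)
  have hp : (a k : ℝ) ≠ 0 := by exact_mod_cast (ha.pos k).ne'
  unfold tailSum
  rw [hs.tsum_eq_zero_add, mul_add, ← tsum_mul_left, add_zero, div_self hp, mul_one]
  congr 1
  refine tsum_congr fun j => ?_
  rw [show k + (j + 1) = k + 1 + j by ring, ha.ratio_cast k]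
  ring

theorem nsmul_coe_tailSum (ha : IsArithSeq a) {M : ℝ} (hf : ∀ n, |f n| ≤ M)
    (hint : ∀ k, ∃ s : ℤ, ratioSeq a (k + 1) * f k = s) (k : ℕ) :
    a k • ((tailSum a f 0 : ℝ) : Circle1) = (tailSum a f k : ℝ) := by
  induction k with
  | zero => rw [ha.1, one_nsmul]
  | succ k ih =>
    obtain ⟨s, hs⟩ := hint k
    rw [ha.succ_eq k, mul_nsmul', ih, ← AddCircle.coe_nsmul, nsmul_eq_mul, tailSum_eq ha hf k, hs,
      AddCircle.coe_add, Circle1.coe_intCast, zero_add]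

theorem tendsto_tailSum (ha : IsArithSeq a) (hf : Tendsto f atTop (𝓝 0)) :
    Tendsto (tailSum a f) atTop (𝓝 0) := by
  rw [Metric.tendsto_atTop] at hf ⊢
  intro ε hε
  obtain ⟨N, hN⟩ := hf (ε / 4) (by positivity)
  refine ⟨N, fun n hn => ?_⟩
  have h := abs_tailSum_le (f := f) ha (M := ε / 4) (k := n) fun m hm => by
    simpa using (hN m (hn.trans hm)).le
  rw [Real.dist_eq, sub_zero]
  linarith

end tailSum

/-- The points characterized by an arithmetic-type sequence containing all of `DSet a` are
killed by some `a k`. -/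
theorem exists_nsmul_eq_zero {a e : ℕ → ℕ} (ha : IsArithSeq a) (he : StrictMono e)
    (hr : Set.range e = DSet a) {x : Circle1} (hx : x ∈ charSub e) : ∃ k, a k • x = 0 := by
  obtain ⟨N, hN⟩ := (Metric.tendsto_atTop.1 hx) (1 / 8) (by norm_num)
  simp only [dist_zero_right] at hN
  have hsmall : ∀ m ∈ DSet a, a (e N) ≤ m → ‖m • x‖ ≤ 1 / 8 := by
    intro m hm hle
    rw [← hr] at hm
    obtain ⟨n, rfl⟩ := hm
    exact (hN n (he.le_iff_le.1 ((ha.2.1.id_le _).trans hle))).le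
  refine ⟨e N, norm_eq_zero.1 (eq_zero_of_doubling (v := fun k => ‖a k • x‖) (norm_nonneg _)
    (fun k => Circle1.norm_le_half _) fun k hk => ?_)⟩
  have h2 := ha.two_le_ratioSeq k
  have h := Circle1.norm_nsmul_eq (x := a k • x) (q := ratioSeq a (k + 1)) h2 fun r h1 hrq => by
    rw [← mul_nsmul']
    exact hsmall _ (ha.mem_DSet_iff.2 ⟨k, r, h1, hrq, rfl⟩)
      ((ha.2.1.monotone hk).trans (Nat.le_mul_of_pos_left _ h1))
  simp only [ha.succ_eq k, mul_nsmul', h]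
  gcongr
  exact_mod_cast h2

theorem mem_charSub_of_nsmul_eq_zero {a e : ℕ → ℕ} (ha : IsArithSeq a) (he : StrictMono e)
    (hr : Set.range e ⊆ DSet a) {x : Circle1} {K : ℕ} (hx : a K • x = 0) : x ∈ charSub e := by
  refine tendsto_const_nhds.congr' ?_
  filter_upwards [eventually_ge_atTop (a K)] with n hn
  obtain ⟨k, r, -, hrq, hm⟩ := ha.mem_DSet_iff.1 (hr ⟨n, rfl⟩)
  have hK : K ≤ k := ha.le_index hrq (by rw [← hm]; exact hn.trans (he.id_le n))
  obtain ⟨c, hc⟩ := ha.dvd_of_le hK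
  rw [hm, hc, mul_comm (a K), ← mul_assoc, mul_nsmul', hx, nsmul_zero]

theorem mem_of_nsmul_addOrderOf_eq_zero {G : AddSubgroup Circle1} {x y : Circle1} (hy : y ∈ G)
    (h0 : 0 < addOrderOf y) (hx : addOrderOf y • x = 0) : x ∈ G := by
  have hfin : {u : Circle1 | addOrderOf y • u = 0}.Finite := AddCircle.finite_torsion 1 h0
  have hsub : (AddSubgroup.zmultiples y : Set Circle1) ⊆ {u | addOrderOf y • u = 0} := by
    rintro _ ⟨m, rfl⟩
    simp only [Set.mem_ofPred_eq, smul_comm (addOrderOf y) m y, addOrderOf_nsmul_eq_zero,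
      smul_zero]
  have hcard : {u : Circle1 | addOrderOf y • u = 0}.ncard ≤
      (AddSubgroup.zmultiples y : Set Circle1).ncard := by
    have h1 : (AddSubgroup.zmultiples y : Set Circle1).ncard = addOrderOf y :=
      Nat.card_zmultiples y
    rw [h1]
    have h2 := AddCircle.card_torsion_le_of_isSMulRegular (1 : ℝ) (addOrderOf y) h0.ne'
      (.of_right_eq_zero_of_smul fun _ ↦ by simp [h0.ne'])
    rw [← hfin.cast_ncard_eq] at h2
    exact_mod_cast h2
  have := Set.eq_of_subset_of_ncard_le hsub hcard hfin
  exact (AddSubgroup.zmultiples_le_of_mem hy) (this.ge hx)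

theorem exists_arithSeq {G : AddSubgroup Circle1} (hGc : (G : Set Circle1).Countable)
    (hGinf : (G : Set Circle1).Infinite) (hG : ∀ x ∈ G, IsOfFinAddOrder x) :
    ∃ a, IsArithSeq a ∧ ∀ x, x ∈ G ↔ ∃ k, a k • x = 0 := by
  have : Countable G := hGc
  obtain ⟨g, hg⟩ := exists_surjective_nat G
  have hunb : ∀ m : ℕ, ∃ y ∈ G, m < addOrderOf y := by
    intro m
    by_contra! h
    refine hGinf ((Set.Finite.biUnion (Set.finite_Icc 1 m) fun n hn =>
      AddCircle.finite_setOfPred_addOrderOf_eq (1 : ℝ) (n := n) hn.1).subset fun x hx => ?_)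
    simp only [Set.mem_iUnion]
    exact ⟨addOrderOf x, ⟨(hG x hx).addOrderOf_pos, h x hx⟩, rfl⟩
  have hstep : ∀ (n : ℕ) (y : G), ∃ z : G, addOrderOf y < addOrderOf z ∧
      addOrderOf y ∣ addOrderOf z ∧ addOrderOf (g n) ∣ addOrderOf z := by
    intro n y
    obtain ⟨w, hw, hlt⟩ := hunb (addOrderOf y)
    obtain ⟨u, -, hu⟩ := (AddCommute.all y (g n)).exists_addOrderOf_eq_lcm
    obtain ⟨z, -, hz⟩ := (AddCommute.all u (⟨w, hw⟩ : G)).exists_addOrderOf_eq_lcm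
    have hwz : addOrderOf (⟨w, hw⟩ : G) ∣ addOrderOf z := hz ▸ Nat.dvd_lcm_right _ _
    have huz : addOrderOf u ∣ addOrderOf z := hz ▸ Nat.dvd_lcm_left _ _
    have hzpos : 0 < addOrderOf z := by
      rw [← AddSubgroup.addOrderOf_coe]
      exact (hG z z.2).addOrderOf_pos
    refine ⟨z, lt_of_lt_of_le ?_ (Nat.le_of_dvd hzpos hwz), ?_, ?_⟩
    · simpa [← AddSubgroup.addOrderOf_coe] using hlt
    · exact (hu ▸ Nat.dvd_lcm_left _ _ : addOrderOf y ∣ addOrderOf u).trans huz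
    · exact (hu ▸ Nat.dvd_lcm_right _ _ : addOrderOf (g n) ∣ addOrderOf u).trans huz
  choose F hF1 hF2 hF3 using hstep
  let y : ℕ → G := fun n => Nat.rec 0 F n
  refine ⟨fun n => addOrderOf (y n), ⟨by simp [y], strictMono_nat_of_lt_succ fun n => hF1 n (y n),
    fun n => hF2 n (y n)⟩, fun x => ⟨fun hx => ?_, fun ⟨k, hk⟩ => ?_⟩⟩
  · obtain ⟨n, hn⟩ := hg ⟨x, hx⟩
    refine ⟨n + 1, addOrderOf_dvd_iff_nsmul_eq_zero.1 ?_⟩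
    have := hF3 n (y n)
    rwa [hn, AddSubgroup.addOrderOf_mk] at this
  · simp only [← AddSubgroup.addOrderOf_coe] at hk
    exact mem_of_nsmul_addOrderOf_eq_zero (y k).2 (hG _ (y k).2).addOrderOf_pos hk

open Classical in
theorem exists_characterizing_of_torsion {G : AddSubgroup Circle1}
    (hGc : (G : Set Circle1).Countable) (hGinf : (G : Set Circle1).Infinite)
    (hG : ∀ x ∈ G, IsOfFinAddOrder x) :
    ∃ a e : ℕ → ℕ, IsArithSeq a ∧ IsArithTypeSeq a e ∧ (G : Set Circle1) = charSub e := by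
  obtain ⟨a, ha, haG⟩ := exists_arithSeq hGc hGinf hG
  have hinf : Infinite (DSet a) := by
    refine ((Set.infinite_range_of_injective ha.2.1.injective).mono ?_).to_subtype
    rintro _ ⟨k, rfl⟩
    exact ha.mem_DSet k
  have hmono := (Nat.orderEmbeddingOfSet (DSet a)).strictMono
  have hrange := Nat.orderEmbeddingOfSet_range (DSet a)
  refine ⟨a, Nat.orderEmbeddingOfSet (DSet a), ha,
    ⟨hmono, fun k _ => hrange.ge (ha.mem_DSet k), hrange.le⟩, Set.ext fun x => ?_⟩
  refine (haG x).trans ⟨fun ⟨k, hk⟩ => ?_, exists_nsmul_eq_zero ha hmono hrange⟩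
  exact mem_charSub_of_nsmul_eq_zero ha hmono hrange.le hk

/-- If an arithmetic-type sequence characterizes a point of infinite order, then it
characterizes uncountably many points. -/
theorem not_countable_charSub {a e : ℕ → ℕ} (ha : IsArithSeq a) (he : IsArithTypeSeq a e)
    {x : Circle1} (hx : x ∈ charSub e) (hx' : ¬ IsOfFinAddOrder x) :
    ¬ (charSub e).Countable := by
  obtain ⟨hmono, hmem, hsub⟩ := he
  obtain ⟨z, rfl⟩ := QuotientAddGroup.mk_surjective x
  change Tendsto (fun n => e n • (z : Circle1)) atTop (𝓝 0) at hx
  set q : ℕ → ℕ := fun k => ratioSeq a (k + 1) with hq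
  have hq0 : ∀ k, (0 : ℝ) < q k := fun k => by
    have := ha.two_le_ratioSeq k
    simp only [hq]
    exact_mod_cast (by omega : 0 < ratioSeq a (k + 1))
  set y : ℕ → ℝ := fun k => a k * z - round (a k * z) with hy
  set d : ℕ → ℤ := fun k => round (a (k + 1) * z) - q k * round (a k * z) with hd
  have hyd : ∀ k, q k * y k = d k + y (k + 1) := by
    intro k
    simp only [hy, hd, ha.ratio_cast k]
    push_cast
    ring
  have hcoe : ∀ k, a k • (z : Circle1) = (y k : ℝ) := by
    intro k
    rw [← AddCircle.coe_nsmul, nsmul_eq_mul]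
    simp only [hy]
    rw [AddCircle.coe_sub, Circle1.coe_intCast, sub_zero]
  have hnorm : ∀ k, ‖a k • (z : Circle1)‖ = |y k| := by
    intro k
    rw [← AddCircle.coe_nsmul, nsmul_eq_mul, UnitAddCircle.norm_eq]
  have hy0 : Tendsto y atTop (𝓝 0) := by
    rw [Metric.tendsto_atTop] at hx ⊢
    intro ε hε
    obtain ⟨N, hN⟩ := hx ε hε
    refine ⟨e N + 1, fun k hk => ?_⟩
    obtain ⟨n, hn⟩ := hmem k (by omega)
    have h1 : N ≤ n := by
      rw [← hmono.le_iff_le, hn]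
      exact (Nat.le_of_succ_le hk).trans (ha.2.1.id_le k)
    have h2 := hN n h1
    rwa [hn, dist_zero_right, hnorm, ← Real.norm_eq_abs, ← dist_zero_right] at h2
  have hy1 : Tendsto (fun k => y (k + 1)) atTop (𝓝 0) := hy0.comp (tendsto_add_atTop_nat 1)
  have hb0 : Tendsto (fun k => (d k : ℝ) / q k) atTop (𝓝 0) := by
    have hlim : Tendsto (fun k => |y k| + |y (k + 1)|) atTop (𝓝 0) := by
      simpa using hy0.abs.add hy1.abs
    refine squeeze_zero_norm (fun k => ?_) hlim
    have h1 : (1 : ℝ) ≤ q k := by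
      have : 0 < q k := by exact_mod_cast hq0 k
      exact_mod_cast this
    have h2 : (d k : ℝ) / q k = y k - y (k + 1) / q k := by
      rw [eq_sub_iff_add_eq, ← add_div, ← hyd, mul_div_cancel_left₀ _ (hq0 k).ne']
    rw [h2, Real.norm_eq_abs]
    refine (abs_sub _ _).trans ?_
    rw [abs_div, abs_of_pos (hq0 k)]
    gcongr
    exact div_le_self (abs_nonneg _) h1
  obtain ⟨N, hN⟩ := (Metric.tendsto_atTop.1 hb0) (1 / 16) (by norm_num)
  simp only [dist_zero_right, Real.norm_eq_abs] at hN
  set S : Set ℕ := {k | N ≤ k ∧ d k ≠ 0} with hS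
  have hSinf : S.Infinite := by
    intro hfin
    obtain ⟨B, hB⟩ := hfin.bddAbove
    have hz : ∀ k, N + B + 1 ≤ k → d k = 0 := by
      intro k hk
      by_contra hne
      have := hB (show k ∈ S from ⟨by omega, hne⟩)
      omega
    have h0 : |y (N + B + 1)| = 0 := by
      refine eq_zero_of_doubling (v := fun k => |y k|) (C := 1 / 2) (abs_nonneg _)
        (fun k => abs_sub_round _) fun k hk => ?_
      have h1 := hyd k
      rw [hz k hk, Int.cast_zero, zero_add] at h1
      simp only [← h1, abs_mul, Nat.abs_cast]
      gcongr
      exact_mod_cast ha.two_le_ratioSeq k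
    rw [← hnorm, norm_eq_zero] at h0
    exact hx' (isOfFinAddOrder_iff_nsmul_eq_zero.2 ⟨_, ha.pos _, h0⟩)
  classical
  set f : Set ℕ → ℕ → ℝ := fun A k => if k ∈ A then (d k : ℝ) / q k else 0 with hf
  have hfle : ∀ A k, |f A k| ≤ |(d k : ℝ) / q k| := by
    intro A k
    simp only [hf]
    split_ifs <;> simp
  have hfS : ∀ A ⊆ S, ∀ k, |f A k| ≤ 1 / 16 := by
    intro A hA k
    by_cases hk : k ∈ A
    · exact (hfle A k).trans (hN k (hA hk).1).le
    · simp [hf, hk]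
  have hf0 : ∀ A, Tendsto (f A) atTop (𝓝 0) := fun A =>
    squeeze_zero_norm (hfle A) (by simpa using hb0.abs)
  have hfq : ∀ A k, q k * f A k = if k ∈ A then (d k : ℝ) else 0 := by
    intro A k
    simp only [hf]
    split_ifs
    · rw [mul_div_cancel₀ _ (hq0 k).ne']
    · simp
  have hint : ∀ A k, ∃ s : ℤ, q k * f A k = s := by
    intro A k
    rw [hfq]
    split_ifs
    exacts [⟨d k, rfl⟩, ⟨0, by simp⟩]
  have hpt : ∀ A ⊆ S, ((tailSum a (f A) 0 : ℝ) : Circle1) ∈ charSub e := by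
    intro A hA
    have hT := (tendsto_tailSum ha (hf0 A)).comp (tendsto_add_atTop_nat 1)
    have hbound : ∀ k r : ℕ, r < q k → ‖(r * a k) • ((tailSum a (f A) 0 : ℝ) : Circle1)‖ ≤
        ‖(r * a k) • (z : Circle1)‖ + (|y (k + 1)| + |tailSum a (f A) (k + 1)|) := by
      intro k r hr
      have hrq : (r : ℝ) / q k ≤ 1 := (div_le_one (hq0 k)).2 (by exact_mod_cast hr.le)
      have hsm : ∀ t : ℝ, ‖((r / q k * t : ℝ) : Circle1)‖ ≤ |t| := fun t => by
        refine (Circle1.norm_coe_le_abs _).trans ?_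
        rw [abs_mul, abs_of_nonneg (by positivity)]
        exact mul_le_of_le_one_left (abs_nonneg _) hrq
      have e1 : (r * a k) • ((tailSum a (f A) 0 : ℝ) : Circle1) =
          ((r * f A k : ℝ) : Circle1) + ((r / q k * tailSum a (f A) (k + 1) : ℝ) : Circle1) := by
        rw [mul_nsmul', nsmul_coe_tailSum ha (hfS A hA) (hint A), ← AddCircle.coe_nsmul,
          nsmul_eq_mul, ← AddCircle.coe_add]
        congr 1
        have := tailSum_eq ha (hfS A hA) k
        have hne := (hq0 k).ne'
        field_simp
        linear_combination (r : ℝ) * this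
      have e2 : ((r * (d k / q k) : ℝ) : Circle1) =
          (r * a k) • (z : Circle1) - ((r / q k * y (k + 1) : ℝ) : Circle1) := by
        rw [mul_nsmul', hcoe, ← AddCircle.coe_nsmul, nsmul_eq_mul, ← AddCircle.coe_sub]
        congr 1
        have := hyd k
        have hne := (hq0 k).ne'
        field_simp
        linear_combination -(r : ℝ) * this
      have e3 : ‖((r * f A k : ℝ) : Circle1)‖ ≤ ‖((r * (d k / q k) : ℝ) : Circle1)‖ := by
        simp only [hf]
        split_ifs
        · exact le_rfl
        · simp
      rw [e1]
      refine (norm_add_le _ _).trans ?_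
      rw [← add_assoc]
      refine add_le_add (e3.trans ?_) (hsm _)
      rw [e2]
      exact (norm_sub_le _ _).trans (add_le_add le_rfl (hsm _))
    choose κ ρ hρ1 hρ hκ using fun n => ha.mem_DSet_iff.1 (hsub ⟨n, rfl⟩)
    have hκtop : Tendsto κ atTop atTop := by
      refine tendsto_atTop.2 fun K => ?_
      filter_upwards [eventually_ge_atTop (a K)] with n hn
      exact ha.le_index (hρ n) (by rw [← hκ]; exact hn.trans (hmono.id_le n))
    have hlim : Tendsto (fun k => |y (k + 1)| + |tailSum a (f A) (k + 1)|) atTop (𝓝 0) := by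
      simpa using hy1.abs.add hT.abs
    have hlim2 := (tendsto_norm_zero.comp hx).add (hlim.comp hκtop)
    rw [add_zero] at hlim2
    refine squeeze_zero_norm (fun n => ?_) hlim2
    have := hbound (κ n) (ρ n) (hρ n)
    rw [← hκ] at this
    exact this
  have hinj : ∀ A ⊆ S, ∀ B ⊆ S,
      ((tailSum a (f A) 0 : ℝ) : Circle1) = ((tailSum a (f B) 0 : ℝ) : Circle1) → A = B := by
    intro A hA B hB hAB
    have hle : ∀ A ⊆ S, ∀ k, |tailSum a (f A) k| ≤ 1 / 8 := fun A hA k =>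
      (abs_tailSum_le ha fun n _ => hfS A hA n).trans (by norm_num)
    have hTeq : ∀ k, tailSum a (f A) k = tailSum a (f B) k := by
      intro k
      have h1 : ((tailSum a (f A) k : ℝ) : Circle1) = (tailSum a (f B) k : ℝ) := by
        rw [← nsmul_coe_tailSum ha (hfS A hA) (hint A), hAB,
          nsmul_coe_tailSum ha (hfS B hB) (hint B)]
      rw [← sub_eq_zero, ← AddCircle.coe_sub, ← norm_eq_zero, Circle1.norm_coe_eq_abs, abs_eq_zero,
        sub_eq_zero] at h1
      · exact h1
      · exact (abs_sub _ _).trans (by linarith [hle A hA k, hle B hB k])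
    have hfeq : ∀ k, q k * f A k = q k * f B k := by
      intro k
      have h1 := tailSum_eq ha (hfS A hA) k
      have h2 := tailSum_eq ha (hfS B hB) k
      rw [hTeq, hTeq (k + 1)] at h1
      linarith
    ext k
    have h1 := hfeq k
    rw [hfq, hfq] at h1
    by_cases hkA : k ∈ A <;> by_cases hkB : k ∈ B <;> simp only [hkA, hkB, if_true,
      if_false] at h1 ⊢
    · exact absurd (by exact_mod_cast h1) (hA hkA).2
    · exact absurd (by exact_mod_cast h1.symm) (hB hkB).2
  intro hcount
  have : Infinite S := hSinf.to_subtype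
  have hσ : ∀ B : Set ℕ, Nat.orderEmbeddingOfSet S '' B ⊆ S := by
    rintro B _ ⟨n, -, rfl⟩
    exact (Nat.orderEmbeddingOfSet_range S).le (Set.mem_range_self n)
  have : Countable (charSub e) := hcount
  obtain ⟨c, hc⟩ := exists_injective_nat (charSub e)
  refine Function.cantor_injective (fun B : Set ℕ => c ⟨_, hpt _ (hσ B)⟩) fun B B' h => ?_
  exact (Set.image_injective.2 (Nat.orderEmbeddingOfSet S).injective)
    (hinj _ (hσ B) _ (hσ B') (congrArg Subtype.val (hc h)))

/-- a countably infinite subgroup of `𝕋` is characterized by an arithmetic-type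
sequence if and only if it is torsion. -/
theorem countable_subgroup_characterized_iff_torsion (G : AddSubgroup Circle1)
    (hGc : (G : Set Circle1).Countable) (hGinf : (G : Set Circle1).Infinite) :
    (∃ (a e : ℕ → ℕ), IsArithSeq a ∧ IsArithTypeSeq a e ∧
        (G : Set Circle1) = charSub e) ↔
      ∀ x ∈ G, IsOfFinAddOrder x := by
  constructor
  · rintro ⟨a, e, ha, he, hGe⟩ x hx
    by_contra hx'
    rw [hGe] at hGc
    exact not_countable_charSub ha he (hGe ▸ hx : x ∈ charSub e) hx' hGc
  · exact exists_characterizing_of_torsion hGc hGinf
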